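/- Let n ≥ 3 be an integer, let τ > (n−2)/2, and let a > 0, C > 0, λ₀ > 1. There exists no differentiable function w : [λ₀, ∞) → ℝ satisfying, for all λ ≥ λ₀, all three of the following: w(λ) ≤ −a·(log λ)^{−1}; w'(λ) ≤ (n−2)·λ^{−1}·w(λ) + C·λ^{(n−3)−2τ}; and w(λ) ≥ −C·λ^{(n−2)−τ}. -/

import Mathlib

open MeasureTheory Real Filter Topology Finset

noncomputable section

/-- Partial derivative of `f` in the `i`-th coordinate direction. -/
def pd {n : ℕ} (i : Fin n) (f : EuclideanSpace ℝ (Fin n) → ℝ)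
    (x : EuclideanSpace ℝ (Fin n)) : ℝ :=
  fderiv ℝ f x (EuclideanSpace.single i 1)

/-- The closed upper half-space `{x : x iN ≥ 0}`. -/
def halfSpace {n : ℕ} (iN : Fin n) : Set (EuclideanSpace ℝ (Fin n)) :=
  {x | 0 ≤ x iN}

/-- The boundary hyperplane `{x : x iN = 0}`. -/
def bdry {n : ℕ} (iN : Fin n) : Set (EuclideanSpace ℝ (Fin n)) :=
  {x | x iN = 0}

/-- Christoffel symbols `Γ^k_{ij}` of a metric `g`. -/
def christoffel {n : ℕ} (g : EuclideanSpace ℝ (Fin n) → Matrix (Fin n) (Fin n) ℝ)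
    (k i j : Fin n) (x : EuclideanSpace ℝ (Fin n)) : ℝ :=
  (1 / 2) * ∑ l, (g x)⁻¹ k l *
    (pd i (fun y => g y j l) x + pd j (fun y => g y i l) x - pd l (fun y => g y i j) x)

/-- The Laplace–Beltrami operator of the metric `g`. -/
def laplaceBeltrami {n : ℕ} (g : EuclideanSpace ℝ (Fin n) → Matrix (Fin n) (Fin n) ℝ)
    (u : EuclideanSpace ℝ (Fin n) → ℝ) (x : EuclideanSpace ℝ (Fin n)) : ℝ :=
  ∑ i, ∑ j, (g x)⁻¹ i j *
    (pd i (pd j u) x - ∑ k, christoffel g k i j x * pd k u x)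

/-- The inward-pointing `g`-unit normal to the boundary hyperplane, as a vector. -/
def nuVec {n : ℕ} (iN : Fin n) (g : EuclideanSpace ℝ (Fin n) → Matrix (Fin n) (Fin n) ℝ)
    (y : EuclideanSpace ℝ (Fin n)) : EuclideanSpace ℝ (Fin n) :=
  (WithLp.equiv 2 (Fin n → ℝ)).symm fun i =>
    (g y)⁻¹ i iN / Real.sqrt ((g y)⁻¹ iN iN)

/-- Normal derivative `D_{ν_g} u` at a boundary point. -/
def nuDeriv {n : ℕ} (iN : Fin n) (g : EuclideanSpace ℝ (Fin n) → Matrix (Fin n) (Fin n) ℝ)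
    (u : EuclideanSpace ℝ (Fin n) → ℝ) (y : EuclideanSpace ℝ (Fin n)) : ℝ :=
  ∑ i, nuVec iN g y i * pd i u y

/-- `g` is a `C^m` Riemannian metric on the half-space. -/
def IsCmMetric {n : ℕ} (m : ℕ) (iN : Fin n)
    (g : EuclideanSpace ℝ (Fin n) → Matrix (Fin n) (Fin n) ℝ) : Prop :=
  (∀ i j, ContDiffOn ℝ m (fun y => g y i j) (halfSpace iN)) ∧
    ∀ x ∈ halfSpace iN, (g x).IsSymm ∧ (g x).PosDef

/-- `g` is `C²`-asymptotically flat of rate `τ` on the half-space. -/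
def IsAsymptoticallyFlat {n : ℕ} (iN : Fin n) (τ : ℝ)
    (g : EuclideanSpace ℝ (Fin n) → Matrix (Fin n) (Fin n) ℝ) : Prop :=
  ∃ C₀ > 0, ∀ x ∈ halfSpace iN, 1 ≤ ‖x‖ →
    (∀ i j, |g x i j - (1 : Matrix (Fin n) (Fin n) ℝ) i j| ≤ C₀ * ‖x‖ ^ (-τ)) ∧
    (∀ i j k, |pd k (fun y => g y i j) x| ≤ C₀ * ‖x‖ ^ (-1 - τ)) ∧
    (∀ i j k l, |pd l (pd k (fun y => g y i j)) x| ≤ C₀ * ‖x‖ ^ (-2 - τ))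

/-- The closed upper half-sphere of radius `lam`. -/
def halfSphere {n : ℕ} (iN : Fin n) (lam : ℝ) : Set (EuclideanSpace ℝ (Fin n)) :=
  {x | ‖x‖ = lam ∧ 0 ≤ x iN}

/-- The flux integral `∫_{ℝⁿ₊ ∩ S_λ} Σᵢ xⁱ ∂ᵢu dμ(ḡ)`, with `dμ(ḡ)` the
`(n-1)`-dimensional Euclidean (Hausdorff) surface measure. -/
def flux {n : ℕ} (iN : Fin n) (u : EuclideanSpace ℝ (Fin n) → ℝ) (lam : ℝ) : ℝ :=
  ∫ x in halfSphere iN lam, (∑ i, x i * pd i u x) ∂(μH[(n : ℝ) - 1])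

/-- Euclidean norm of the gradient. -/
def gradNorm {n : ℕ} (u : EuclideanSpace ℝ (Fin n) → ℝ) (x : EuclideanSpace ℝ (Fin n)) : ℝ :=
  Real.sqrt (∑ i, (pd i u x) ^ 2)

/-- Frobenius norm of the Hessian. -/
def hessNorm {n : ℕ} (u : EuclideanSpace ℝ (Fin n) → ℝ) (x : EuclideanSpace ℝ (Fin n)) : ℝ :=
  Real.sqrt (∑ i, ∑ j, (pd i (pd j u) x) ^ 2)

/-- The Euclidean Laplacian. -/
def euclLap {n : ℕ} (u : EuclideanSpace ℝ (Fin n) → ℝ) (x : EuclideanSpace ℝ (Fin n)) : ℝ :=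
  ∑ i, pd i (pd i u) x

/-- The barrier function associated to `τ` and `η`. -/
def barrier {n : ℕ} (iN : Fin n) (τ : ℝ) (η : ℝ → ℝ)
    (x : EuclideanSpace ℝ (Fin n)) : ℝ :=
  -(Real.log ‖x‖)⁻¹ * ‖x‖ ^ ((2 : ℝ) - n) + η (x iN / ‖x‖) * ‖x‖ ^ ((2 : ℝ) - n - τ)

/-- The Euclidean area of the unit `(n-1)`-sphere in `ℝⁿ`. -/
def sphereArea (n : ℕ) : ℝ :=
  (μH[(n : ℝ) - 1] (Metric.sphere (0 : EuclideanSpace ℝ (Fin n)) 1)).toReal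

/-- The quantity whose limit (after normalization) is the half-space mass. -/
def massExpr {n : ℕ} (iN : Fin n)
    (g : EuclideanSpace ℝ (Fin n) → Matrix (Fin n) (Fin n) ℝ) (lam : ℝ) : ℝ :=
  lam⁻¹ *
    ((∫ x in halfSphere iN lam,
        (∑ i, ∑ j, x i * (pd j (fun y => g y i j) x - pd i (fun y => g y j j) x))
        ∂(μH[(n : ℝ) - 1])) +
      ∫ x in {x : EuclideanSpace ℝ (Fin n) | ‖x‖ = lam ∧ x iN = 0},
        (∑ i ∈ Finset.univ.erase iN, x i * g x i iN) ∂(μH[(n : ℝ) - 2]))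

/-- `m` is the half-space (ADM-type) mass of `g`. -/
def HasHalfSpaceMass {n : ℕ} (iN : Fin n)
    (g : EuclideanSpace ℝ (Fin n) → Matrix (Fin n) (Fin n) ℝ) (m : ℝ) : Prop :=
  Filter.Tendsto (fun lam => (2 * ((n : ℝ) - 1) * sphereArea n)⁻¹ * massExpr iN g lam)
    Filter.atTop (nhds m)

/-- Membership in the weighted Hölder space `C^{2,α}_τ(ℝⁿ₊)`. -/
def MemC2AlphaTau {n : ℕ} (iN : Fin n) (α τ : ℝ)
    (u : EuclideanSpace ℝ (Fin n) → ℝ) : Prop :=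
  ContDiffOn ℝ 2 u (halfSpace iN) ∧
  ∃ C₁ > 0,
    (∀ x ∈ halfSpace iN,
      |u x| ≤ C₁ * (1 + ‖x‖) ^ (-τ) ∧
      (∀ i, |pd i u x| ≤ C₁ * (1 + ‖x‖) ^ (-1 - τ)) ∧
      (∀ i j, |pd i (pd j u) x| ≤ C₁ * (1 + ‖x‖) ^ (-2 - τ))) ∧
    ∀ x₁ ∈ halfSpace iN, ∀ x₂ ∈ halfSpace iN, 1 ≤ ‖x₁‖ → 2 * ‖x₁ - x₂‖ ≤ ‖x₁‖ →
      ∀ i j, |pd i (pd j u) x₁ - pd i (pd j u) x₂| ≤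
        C₁ * ‖x₁ - x₂‖ ^ α * ‖x₁‖ ^ (-2 - τ - α)


/-- A function obeying the differential inequality `w' ≤ m w / x + C x ^ (m - 1 - 2 τ)` becomes
nonincreasing after multiplication by `x ^ (-m)` and addition of `C / (2 τ) * x ^ (-2 τ)`. -/
theorem antitoneOn_rpow_mul_add_rpow {m τ C x₀ : ℝ} (hτ : τ ≠ 0) (hx₀ : 0 < x₀)
    {w w' : ℝ → ℝ}
    (hw : ∀ x, x₀ ≤ x → HasDerivWithinAt w (w' x) (Set.Ici x₀) x)
    (hw' : ∀ x, x₀ ≤ x → w' x ≤ m * x⁻¹ * w x + C * x ^ (m - 1 - 2 * τ)) :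
    AntitoneOn (fun x => x ^ (-m) * w x + C / (2 * τ) * x ^ (-(2 * τ))) (Set.Ici x₀) := by
  have hderiv : ∀ x, x₀ ≤ x → HasDerivWithinAt
      (fun x => x ^ (-m) * w x + C / (2 * τ) * x ^ (-(2 * τ)))
      ((-m * x ^ (-m - 1)) * w x + x ^ (-m) * w' x
        + C / (2 * τ) * (-(2 * τ) * x ^ (-(2 * τ) - 1))) (Set.Ici x₀) x := by
    intro x hx
    have hx0 : x ≠ 0 := (hx₀.trans_le hx).ne'
    exact ((Real.hasDerivAt_rpow_const (Or.inl hx0)).hasDerivWithinAt.mul (hw x hx)).add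
      ((Real.hasDerivAt_rpow_const (Or.inl hx0)).hasDerivWithinAt.const_mul _)
  refine antitoneOn_of_hasDerivWithinAt_nonpos (convex_Ici x₀)
    (fun x hx => (hderiv x hx).continuousWithinAt)
    (fun x hx => (hderiv x (interior_subset hx)).mono interior_subset) fun x hx => ?_
  have hx : x₀ ≤ x := interior_subset hx
  have hx0 : 0 < x := hx₀.trans_le hx
  have h1 : x ^ (-m - 1) = x ^ (-m) * x⁻¹ := by
    rw [Real.rpow_sub hx0, Real.rpow_one, div_eq_mul_inv]
  have h2 : x ^ (-(2 * τ) - 1) = x ^ (-m) * x ^ (m - 1 - 2 * τ) := by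
    rw [← Real.rpow_add hx0]
    congr 1
    ring
  have h3 : C / (2 * τ) * (-(2 * τ) * x ^ (-(2 * τ) - 1)) = -C * x ^ (-(2 * τ) - 1) := by
    field_simp
  rw [h3, h1, h2]
  have h4 := mul_le_mul_of_nonneg_left (hw' x hx) (Real.rpow_nonneg hx0.le (-m))
  linarith

/-- the ODE/growth contradiction in the proof of the asymptotic
growth estimate. -/
theorem stmt5 (n : ℕ) (hn : 3 ≤ n) (τ a C lam₀ : ℝ)
    (hτ : ((n : ℝ) - 2) / 2 < τ) (ha : 0 < a) (hC : 0 < C) (hlam₀ : 1 < lam₀) :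
    ¬ ∃ w w' : ℝ → ℝ,
        (∀ lam, lam₀ ≤ lam → HasDerivWithinAt w (w' lam) (Set.Ici lam₀) lam) ∧
        ∀ lam, lam₀ ≤ lam →
          w lam ≤ -a * (Real.log lam)⁻¹ ∧
          w' lam ≤ ((n : ℝ) - 2) * lam⁻¹ * w lam + C * lam ^ ((n : ℝ) - 3 - 2 * τ) ∧
          -C * lam ^ ((n : ℝ) - 2 - τ) ≤ w lam := by
  rintro ⟨w, w', hderiv, hbound⟩
  have hn' : (3 : ℝ) ≤ n := by exact_mod_cast hn
  have hτ0 : 0 < τ := by linarith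
  have hanti := antitoneOn_rpow_mul_add_rpow (m := (n : ℝ) - 2) (C := C) hτ0.ne'
    (one_pos.trans hlam₀) hderiv fun x hx => by
      convert (hbound x hx).2.1 using 4
      ring
  obtain ⟨x₁, hx₁, hneg⟩ : ∃ x₁, lam₀ ≤ x₁ ∧
      x₁ ^ (-((n : ℝ) - 2)) * w x₁ + C / (2 * τ) * x₁ ^ (-(2 * τ)) < 0 := by
    have hlog := (isLittleO_log_rpow_atTop (r := 2 * τ - ((n : ℝ) - 2)) (by linarith)).bound
      (c := a * τ / C) (by positivity)
    obtain ⟨x, hxlog, hx⟩ := (hlog.and (eventually_ge_atTop lam₀)).exists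
    refine ⟨x, hx, ?_⟩
    have hx1 : 1 < x := hlam₀.trans_le hx
    have hx0 : 0 < x := one_pos.trans hx1
    have hlogpos : 0 < Real.log x := Real.log_pos hx1
    set p := x ^ (-(2 * τ)) with hp
    have hp0 : 0 < p := Real.rpow_pos_of_pos hx0 _
    set q := x ^ (2 * τ - ((n : ℝ) - 2)) with hq
    have hq0 : 0 < q := Real.rpow_pos_of_pos hx0 _
    have hpq : x ^ (-((n : ℝ) - 2)) = p * q := by
      rw [hp, hq, ← Real.rpow_add hx0]
      congr 1
      ring
    rw [Real.norm_of_nonneg hlogpos.le, Real.norm_of_nonneg hq0.le] at hxlog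
    have hCq : C / (2 * τ) < a * q * (Real.log x)⁻¹ := by
      rw [← div_eq_mul_inv, lt_div_iff₀ hlogpos]
      calc C / (2 * τ) * Real.log x ≤ C / (2 * τ) * (a * τ / C * q) := by gcongr
        _ = a * q / 2 := by field_simp
        _ < a * q := half_lt_self (by positivity)
    have hw := mul_le_mul_of_nonneg_left (hbound x hx).1 (mul_pos hp0 hq0).le
    rw [hpq]
    nlinarith [mul_lt_mul_of_pos_left hCq hp0]
  have htend : Tendsto (fun x : ℝ => -C * x ^ (-τ)) atTop (𝓝 0) := by
    simpa using (tendsto_rpow_neg_atTop hτ0).const_mul (-C)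
  obtain ⟨x, hlt, hx⟩ :=
    ((htend.eventually (lt_mem_nhds hneg)).and (eventually_ge_atTop x₁)).exists
  have hx0 : 0 < x := by linarith
  have hle := hanti hx₁ (hx₁.trans hx) hx
  have hlow := mul_le_mul_of_nonneg_left (hbound x (hx₁.trans hx)).2.2
    (Real.rpow_nonneg hx0.le (-((n : ℝ) - 2)))
  have hpow : x ^ (-τ) = x ^ (-((n : ℝ) - 2)) * x ^ ((n : ℝ) - 2 - τ) := by
    rw [← Real.rpow_add hx0]
    congr 1
    ring
  have hpos : 0 < C / (2 * τ) * x ^ (-(2 * τ)) := by positivity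
  rw [hpow] at hlt
  simp only at hle
  linarith

end
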